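/- For n ∈ ω let D_n = {(x,y) ∈ (2^ω)² : ∃i<j (n ≤ i and δ_i^j(x,y) > 3 and ∀m (i ≤ m < j → x(m) ≠ y(m)))}, and let C = ⋂_{n∈ω} D_n. Then each D_n is dense open in (2^ω)² (so C is comeager); if (m_k) is strictly increasing with m_0 = 0 and g⁰, g¹ : 2^{<ω} → 2^{<ω} each satisfy the E_2-tree conditions with respect to (m_k) and in addition δ_{m_{k−1}}^{m_k}(g⁰(s), g¹(s)) < 2^{−(k+1)} for every string s of length k > 0, then the induced maps Φ⁰, Φ¹ satisfy ¬(Φ⁰(0^∞) E_2 Φ¹((01)^∞)) and (Φ⁰(0^∞), Φ¹((01)^∞)) ∉ C; and consequently for all Borel sets B_0, B_1 ⊆ 2^ω each admitting a Borel reduction of E_2 into its restriction and with [B_0]_{E_2} = [B_1]_{E_2}, the set B_0 ×_{E_2} B_1 is not contained in C. Hence E_2 does not have the weak 2-Mycielski property. -/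

import Mathlib

open Set Function

/-- `δ_m^n(x,y) = Σ {1/(k+1) : m ≤ k < n, x k ≠ y k}`. -/
noncomputable def dE2 (m n : ℕ) (x y : ℕ → Bool) : ℝ :=
  ∑ k ∈ Finset.Ico m n, if x k = y k then 0 else 1 / ((k : ℝ) + 1)

/-- The equivalence relation `E₂`: `x E₂ y` iff `Σ {1/(k+1) : x k ≠ y k} < ∞`. -/
def E2 (x y : ℕ → Bool) : Prop :=
  Summable fun k => if x k = y k then (0 : ℝ) else 1 / ((k : ℝ) + 1)

/-- The `E₂`-saturation of a set. -/
def satE2 (A : Set (ℕ → Bool)) : Set (ℕ → Bool) := {y | ∃ x ∈ A, E2 x y}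

/-- `δ_m^n` on finite binary strings (read via `getD`). -/
noncomputable def dE2L (m n : ℕ) (a b : List Bool) : ℝ :=
  ∑ k ∈ Finset.Ico m n, if a.getD k false = b.getD k false then 0 else 1 / ((k : ℝ) + 1)

/-- The `E₂`-tree conditions for `g : 2^{<ω} → 2^{<ω}` with respect to a strictly increasing
sequence `m` with `m 0 = 0`. -/
structure IsE2System (m : ℕ → ℕ) (g : List Bool → List Bool) : Prop where
  mono : StrictMono m
  zero : m 0 = 0
  len : ∀ s, (g s).length = m s.length
  mono_prefix : ∀ s t : List Bool, s <+: t → g s <+: g t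
  close : ∀ (k : ℕ) (s t : List Bool), s.length = k + 1 → t.length = k + 1 →
    s.getD k false = t.getD k false →
    dE2L (m k) (m (k + 1)) (g s) (g t) < 1 / 2 ^ (k + 2)
  far : ∀ (k : ℕ) (s t : List Bool), s.length = k + 1 → t.length = k + 1 →
    s.getD k false ≠ t.getD k false →
    |dE2L (m k) (m (k + 1)) (g s) (g t) - 1 / ((k : ℝ) + 1)| < 1 / 2 ^ (k + 2)

/-- The initial segment `x ↾ n` as a finite string. -/
def seg (x : ℕ → Bool) (n : ℕ) : List Bool := List.ofFn fun i : Fin n => x i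

/-- The map `Φ(x) = ⋃ₙ g(x ↾ n)` induced by an `E₂`-tree system. -/
def e2MapOf (g : List Bool → List Bool) (x : ℕ → Bool) : ℕ → Bool :=
  fun j => (g (seg x (j + 1))).getD j false

/-- The constant sequence `0^∞`. -/
def z0 : ℕ → Bool := fun _ => false

/-- The periodic sequence `(01)^∞`. -/
def z01 : ℕ → Bool := fun n => decide (n % 2 = 1)

/-- `B₀ ×_{E₂} B₁`: pairs with `xᵢ ∈ Bᵢ` which are `E₂`-inequivalent. -/
def prodE2 (B0 B1 : Set (ℕ → Bool)) : Set ((ℕ → Bool) × (ℕ → Bool)) :=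
  {p | p.1 ∈ B0 ∧ p.2 ∈ B1 ∧ ¬E2 p.1 p.2}

/-- The dense open sets whose intersection witnesses the failure of the weak 2-Mycielski
property for `E₂`. -/
def D15 (n : ℕ) : Set ((ℕ → Bool) × (ℕ → Bool)) :=
  {p | ∃ i j, n ≤ i ∧ i < j ∧ dE2 i j p.1 p.2 > 3 ∧ ∀ m, i ≤ m → m < j → p.1 m ≠ p.2 m}

/-- The two sequences coincide below `n`. -/
def AgreeBelow (n : ℕ) (x y : ℕ → Bool) : Prop := ∀ k < n, x k = y k

namespace AgreeBelow

variable {n m : ℕ} {x y z : ℕ → Bool}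

theorem rfl' : AgreeBelow n x x := fun _ _ => rfl

theorem trans (h : AgreeBelow n x y) (h' : AgreeBelow n y z) : AgreeBelow n x z :=
  fun k hk => (h k hk).trans (h' k hk)

theorem mono (h : AgreeBelow n x y) (hm : m ≤ n) : AgreeBelow m x y :=
  fun k hk => h k (hk.trans_le hm)

end AgreeBelow

theorem isOpen_agreeBelow (n : ℕ) (x : ℕ → Bool) : IsOpen {y | AgreeBelow n x y} := by
  have : {y | AgreeBelow n x y} = ⋂ k ∈ Finset.range n, {y : ℕ → Bool | x k = y k} := by
    ext y; simp [AgreeBelow]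
  rw [this]
  refine isOpen_biInter_finset fun k _ => ?_
  exact (isOpen_discrete {b : Bool | x k = b}).preimage (continuous_apply k)

theorem exists_agreeBelow_subset {U : Set (ℕ → Bool)} (hU : IsOpen U) {x : ℕ → Bool}
    (hx : x ∈ U) : ∃ n, ∀ y, AgreeBelow n x y → y ∈ U := by
  obtain ⟨I, u, hu, hsub⟩ := isOpen_pi_iff.1 hU x hx
  refine ⟨I.sup id + 1, fun y hy => hsub fun k hk => ?_⟩
  rw [← hy k (Nat.lt_succ_of_le (Finset.le_sup (f := id) hk))]
  exact (hu k hk).2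

theorem ContinuousOn.exists_agreeBelow {f : (ℕ → Bool) → (ℕ → Bool)} {Y : Set (ℕ → Bool)}
    (hf : ContinuousOn f Y) {x : ℕ → Bool} (hx : x ∈ Y) (n : ℕ) :
    ∃ l, ∀ y ∈ Y, AgreeBelow l x y → AgreeBelow n (f x) (f y) := by
  obtain ⟨U, hU, hUY⟩ := continuousOn_iff'.1 hf _ (isOpen_agreeBelow n (f x))
  have hxU : x ∈ U := by
    have : x ∈ f ⁻¹' {y | AgreeBelow n (f x) y} ∩ Y := ⟨AgreeBelow.rfl', hx⟩
    rw [hUY] at this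
    exact this.1
  obtain ⟨l, hl⟩ := exists_agreeBelow_subset hU hxU
  refine ⟨l, fun y hy hxy => ?_⟩
  have : y ∈ U ∩ Y := ⟨hl y hxy, hy⟩
  rw [← hUY] at this
  exact this.1

section dE2

variable {m n k : ℕ} {x y z x' y' : ℕ → Bool}

theorem dE2_nonneg (m n : ℕ) (x y : ℕ → Bool) : 0 ≤ dE2 m n x y :=
  Finset.sum_nonneg fun k _ => by split_ifs <;> positivity

theorem dE2_self (m n : ℕ) (x : ℕ → Bool) : dE2 m n x x = 0 := by simp [dE2]

theorem dE2_comm (m n : ℕ) (x y : ℕ → Bool) : dE2 m n x y = dE2 m n y x := by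
  simp only [dE2, eq_comm]

theorem dE2_triangle (m n : ℕ) (x y z : ℕ → Bool) :
    dE2 m n x z ≤ dE2 m n x y + dE2 m n y z := by
  rw [dE2, dE2, dE2, ← Finset.sum_add_distrib]
  refine Finset.sum_le_sum fun k _ => ?_
  have : (0 : ℝ) ≤ 1 / ((k : ℝ) + 1) := by positivity
  by_cases h1 : x k = y k <;> by_cases h2 : y k = z k <;> by_cases h3 : x k = z k <;>
    simp_all

theorem dE2_add (h : m ≤ n) (h' : n ≤ k) (x y : ℕ → Bool) :
    dE2 m n x y + dE2 n k x y = dE2 m k x y :=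
  Finset.sum_Ico_consecutive _ h h'

theorem dE2_le_of_subset {m' n' : ℕ} (hm : m' ≤ m) (hn : n ≤ n') (x y : ℕ → Bool) :
    dE2 m n x y ≤ dE2 m' n' x y :=
  Finset.sum_le_sum_of_subset_of_nonneg (Finset.Ico_subset_Ico hm hn) fun k _ _ => by
    split_ifs <;> positivity

theorem dE2_congr_of (hx : ∀ k, m ≤ k → k < n → x k = x' k)
    (hy : ∀ k, m ≤ k → k < n → y k = y' k) : dE2 m n x y = dE2 m n x' y' :=
  Finset.sum_congr rfl fun k hk => by
    rw [Finset.mem_Ico] at hk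
    rw [hx k hk.1 hk.2, hy k hk.1 hk.2]

theorem dE2_congr (hx : AgreeBelow n x x') (hy : AgreeBelow n y y') :
    dE2 m n x y = dE2 m n x' y' :=
  dE2_congr_of (fun k _ => hx k) fun k _ => hy k

/-- The harmonic measure of the interval `[m, n)` is the largest value of `δ_m^n`. -/
theorem dE2_le_of_ne (h : ∀ k, m ≤ k → k < n → x' k ≠ y' k) (x y : ℕ → Bool) :
    dE2 m n x y ≤ dE2 m n x' y' :=
  Finset.sum_le_sum fun k hk => by
    rw [Finset.mem_Ico] at hk
    rw [if_neg (h k hk.1 hk.2)]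
    split_ifs
    · positivity
    · exact le_rfl

theorem exists_lt_dE2_of_ne (m : ℕ) (c : ℝ) :
    ∃ n, ∀ l, n ≤ l → ∀ x y : ℕ → Bool, (∀ k, m ≤ k → k < l → x k ≠ y k) → c < dE2 m l x y := by
  obtain ⟨n, hn⟩ := (Filter.tendsto_atTop.1 Real.tendsto_sum_range_one_div_nat_succ_atTop
    (c + 1 + ∑ i ∈ Finset.range m, 1 / ((i : ℝ) + 1))).exists_forall_of_atTop
  refine ⟨max n m, fun l hl x y hxy => ?_⟩
  have h1 : dE2 m l x y = ∑ i ∈ Finset.Ico m l, 1 / ((i : ℝ) + 1) :=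
    Finset.sum_congr rfl fun k hk => by
      rw [Finset.mem_Ico] at hk
      rw [if_neg (hxy k hk.1 hk.2)]
  have h2 := hn l (by omega)
  rw [h1, Finset.sum_Ico_eq_sub _ (by omega)]
  linarith

end dE2

/-- `δ_m^∞(x, y) ≤ c`. -/
def TailLE (m : ℕ) (c : ℝ) (x y : ℕ → Bool) : Prop := ∀ n, dE2 m n x y ≤ c

namespace TailLE

variable {m m' : ℕ} {c d : ℝ} {x y z : ℕ → Bool}

theorem self (hc : 0 ≤ c) : TailLE m c x x := fun n => by rwa [dE2_self]

theorem symm (h : TailLE m c x y) : TailLE m c y x := fun n => by rw [dE2_comm]; exact h n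

theorem trans (h : TailLE m c x y) (h' : TailLE m d y z) : TailLE m (c + d) x z :=
  fun n => (dE2_triangle m n x y z).trans (add_le_add (h n) (h' n))

theorem mono (h : TailLE m c x y) (hm : m ≤ m') (hc : c ≤ d) : TailLE m' d x y :=
  fun n => ((dE2_le_of_subset hm le_rfl x y).trans (h n)).trans hc

theorem e2 (h : TailLE m c x y) : E2 x y := by
  refine summable_of_sum_range_le (c := dE2 0 m x y + c)
    (fun k => by split_ifs <;> positivity) fun n => ?_
  have h1 : (∑ k ∈ Finset.range n, if x k = y k then (0 : ℝ) else 1 / ((k : ℝ) + 1))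
      = dE2 0 n x y := by rw [dE2, Finset.range_eq_Ico]
  rw [h1]
  have h2 := dE2_le_of_subset (le_refl 0) (le_max_left n m) x y
  rw [← dE2_add (Nat.zero_le m) (le_max_right n m)] at h2
  linarith [h (max n m)]

end TailLE

theorem E2.exists_tailLE {x y : ℕ → Bool} (h : E2 x y) {c : ℝ} (hc : 0 < c) :
    ∃ m, TailLE m c x y := by
  set s := fun k => if x k = y k then (0 : ℝ) else 1 / ((k : ℝ) + 1) with hs
  have hpos : ∀ k, 0 ≤ s k := fun k => by simp only [hs]; split_ifs <;> positivity
  have ht := h.hasSum.tendsto_sum_nat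
  obtain ⟨m, hm⟩ := (ht.eventually (lt_mem_nhds (sub_lt_self (∑' k, s k) hc))).exists
  refine ⟨m, fun n => ?_⟩
  rcases le_total n m with hnm | hnm
  · rw [dE2, Finset.Ico_eq_empty_of_le hnm, Finset.sum_empty]
    exact hc.le
  · have h1 : dE2 m n x y = ∑ k ∈ Finset.range n, s k - ∑ k ∈ Finset.range m, s k :=
      Finset.sum_Ico_eq_sub _ hnm
    have h2 : ∑ k ∈ Finset.range n, s k ≤ ∑' k, s k :=
      h.sum_le_tsum _ fun k _ => hpos k
    rw [h1]
    linarith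

theorem E2.symm {x y : ℕ → Bool} (h : E2 x y) : E2 y x :=
  (h.exists_tailLE one_pos).choose_spec.symm.e2

theorem E2.trans {x y z : ℕ → Bool} (h : E2 x y) (h' : E2 y z) : E2 x z := by
  obtain ⟨m, hm⟩ := h.exists_tailLE one_pos
  obtain ⟨n, hn⟩ := h'.exists_tailLE one_pos
  exact ((hm.mono (le_max_left m n) le_rfl).trans (hn.mono (le_max_right m n) le_rfl)).e2

theorem not_e2_of_ne {x y : ℕ → Bool} {l : ℕ} (h : ∀ k, l ≤ k → x k ≠ y k) : ¬E2 x y := by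
  intro hE
  obtain ⟨m, hm⟩ := hE.exists_tailLE one_pos
  obtain ⟨n, hn⟩ := exists_lt_dE2_of_ne (max l m) 1
  have h1 := hn n le_rfl x y fun k hk _ => h k ((le_max_left _ _).trans hk)
  exact absurd (hm.mono (le_max_right l m) le_rfl n) (not_le.2 h1)

theorem isOpen_D15 (n : ℕ) : IsOpen (D15 n) := by
  have : D15 n = ⋃ i, ⋃ j, ⋃ (_ : n ≤ i), ⋃ (_ : i < j),
      {p : (ℕ → Bool) × (ℕ → Bool) |
        dE2 i j p.1 p.2 > 3 ∧ ∀ m, i ≤ m → m < j → p.1 m ≠ p.2 m} := by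
    ext p; simp only [D15, mem_ofPred_eq, mem_iUnion, exists_prop]
  rw [this]
  refine isOpen_iUnion fun i => isOpen_iUnion fun j => isOpen_iUnion fun _ => isOpen_iUnion
    fun _ => isOpen_iff_mem_nhds.2 fun p hp => ?_
  have hn := prod_mem_nhds ((isOpen_agreeBelow j p.1).mem_nhds AgreeBelow.rfl')
    ((isOpen_agreeBelow j p.2).mem_nhds AgreeBelow.rfl')
  refine Filter.mem_of_superset hn fun q hq => ⟨?_, fun m h1 h2 => ?_⟩
  · rw [← dE2_congr hq.1 hq.2]; exact hp.1
  · rw [← hq.1 m h2, ← hq.2 m h2]; exact hp.2 m h1 h2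

theorem dense_D15 (n : ℕ) : Dense (D15 n) := by
  rintro ⟨x, y⟩
  let w : ℕ → ℕ → Bool := fun l k => if k < l then y k else !x k
  refine mem_closure_of_tendsto (f := fun l => (x, w l)) (b := Filter.atTop)
    (tendsto_const_nhds.prodMk_nhds (tendsto_pi_nhds.2 fun k => ?_)) ?_
  · refine tendsto_const_nhds.congr' ?_
    filter_upwards [Filter.eventually_gt_atTop k] with l hl
    simp [w, hl]
  · filter_upwards [Filter.eventually_ge_atTop n] with l hl
    have hne : ∀ k, l ≤ k → x k ≠ w l k := fun k hk => by simp [w, not_lt.2 hk]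
    obtain ⟨j, hj⟩ := exists_lt_dE2_of_ne l 3
    exact ⟨l, max j (l + 1), hl, by omega,
      hj _ (le_max_left _ _) _ _ fun k hk _ => hne k hk, fun k hk _ => hne k hk⟩

theorem length_seg (x : ℕ → Bool) (n : ℕ) : (seg x n).length = n := by simp [seg]

theorem getD_seg (x : ℕ → Bool) {n k : ℕ} (h : k < n) : (seg x n).getD k false = x k := by
  simp [seg, List.getD_eq_getElem?_getD, h]

theorem seg_prefix (x : ℕ → Bool) {n k : ℕ} (h : n ≤ k) : seg x n <+: seg x k := by
  rw [List.prefix_iff_getElem]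
  exact ⟨by simpa [length_seg] using h, fun i hi => by simp [seg]⟩

theorem List.IsPrefix.getD_eq {l l' : List Bool} (h : l <+: l') {k : ℕ} (hk : k < l.length) :
    l.getD k false = l'.getD k false := by
  obtain ⟨t, rfl⟩ := h
  simp [List.getD_eq_getElem?_getD, List.getElem?_append_left hk]

namespace IsE2System

variable {m : ℕ → ℕ} {g g0 g1 : List Bool → List Bool}

theorem e2MapOf_apply (h : IsE2System m g) (x : ℕ → Bool) {j n : ℕ} (hj : j < m n) :
    e2MapOf g x j = (g (seg x n)).getD j false := by
  have h1 : j < m (j + 1) := h.mono.le_apply.trans_lt (h.mono (Nat.lt_succ_self j))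
  rcases le_total (j + 1) n with hn | hn
  · exact (h.mono_prefix _ _ (seg_prefix x hn)).getD_eq (by rwa [h.len, length_seg])
  · exact ((h.mono_prefix _ _ (seg_prefix x hn)).getD_eq (by rwa [h.len, length_seg])).symm

theorem dE2_e2MapOf (h0 : IsE2System m g0) (h1 : IsE2System m g1) (x y : ℕ → Bool) (k : ℕ) :
    dE2 (m k) (m (k + 1)) (e2MapOf g0 x) (e2MapOf g1 y) =
      dE2L (m k) (m (k + 1)) (g0 (seg x (k + 1))) (g1 (seg y (k + 1))) :=
  Finset.sum_congr rfl fun j hj => by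
    rw [Finset.mem_Ico] at hj
    rw [h0.e2MapOf_apply x hj.2, h1.e2MapOf_apply y hj.2]

theorem dE2_lt_of_eq (h : IsE2System m g) {x y : ℕ → Bool} {k : ℕ} (hk : x k = y k) :
    dE2 (m k) (m (k + 1)) (e2MapOf g x) (e2MapOf g y) < 1 / 2 ^ (k + 2) := by
  rw [h.dE2_e2MapOf h]
  refine h.close k _ _ (length_seg _ _) (length_seg _ _) ?_
  rwa [getD_seg _ k.lt_succ_self, getD_seg _ k.lt_succ_self]

theorem abs_dE2_lt_of_ne (h : IsE2System m g) {x y : ℕ → Bool} {k : ℕ} (hk : x k ≠ y k) :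
    |dE2 (m k) (m (k + 1)) (e2MapOf g x) (e2MapOf g y) - 1 / ((k : ℝ) + 1)| <
      1 / 2 ^ (k + 2) := by
  rw [h.dE2_e2MapOf h]
  refine h.far k _ _ (length_seg _ _) (length_seg _ _) ?_
  rwa [getD_seg _ k.lt_succ_self, getD_seg _ k.lt_succ_self]

section pair

variable (h0 : IsE2System m g0) (h1 : IsE2System m g1)
  (h01 : ∀ (k : ℕ) (s : List Bool), s.length = k + 1 →
    dE2L (m k) (m (k + 1)) (g0 s) (g1 s) < 1 / 2 ^ (k + 2))

include h0 h1 h01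

theorem dE2_self_lt (x : ℕ → Bool) (k : ℕ) :
    dE2 (m k) (m (k + 1)) (e2MapOf g0 x) (e2MapOf g1 x) < 1 / 2 ^ (k + 2) := by
  rw [h0.dE2_e2MapOf h1]
  exact h01 k _ (length_seg _ _)

theorem dE2_pair_lt_of_eq {x y : ℕ → Bool} {k : ℕ} (hk : x k = y k) :
    dE2 (m k) (m (k + 1)) (e2MapOf g0 x) (e2MapOf g1 y) < 2 / 2 ^ (k + 2) := by
  have := dE2_triangle (m k) (m (k + 1)) (e2MapOf g0 x) (e2MapOf g0 y) (e2MapOf g1 y)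
  have h2 := h0.dE2_lt_of_eq hk
  have h3 := h0.dE2_self_lt h1 h01 y k
  have : (2 : ℝ) / 2 ^ (k + 2) = 1 / 2 ^ (k + 2) + 1 / 2 ^ (k + 2) := by ring
  linarith

theorem abs_dE2_pair_lt_of_ne {x y : ℕ → Bool} {k : ℕ} (hk : x k ≠ y k) :
    |dE2 (m k) (m (k + 1)) (e2MapOf g0 x) (e2MapOf g1 y) - 1 / ((k : ℝ) + 1)| <
      2 / 2 ^ (k + 2) := by
  have h4 := dE2_triangle (m k) (m (k + 1)) (e2MapOf g0 x) (e2MapOf g0 y) (e2MapOf g1 y)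
  have h5 := dE2_triangle (m k) (m (k + 1)) (e2MapOf g0 x) (e2MapOf g1 y) (e2MapOf g0 y)
  rw [dE2_comm _ _ (e2MapOf g1 y)] at h5
  have h2 := abs_lt.1 (h0.abs_dE2_lt_of_ne hk)
  have h3 := h0.dE2_self_lt h1 h01 y k
  have : (2 : ℝ) / 2 ^ (k + 2) = 1 / 2 ^ (k + 2) + 1 / 2 ^ (k + 2) := by ring
  exact abs_lt.2 ⟨by linarith, by linarith⟩

theorem dE2_z0_z01_le_one (k : ℕ) :
    dE2 (m k) (m (k + 1)) (e2MapOf g0 z0) (e2MapOf g1 z01) ≤ 1 := by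
  have h4 : (1 : ℝ) ≤ 2 ^ k := one_le_pow₀ one_le_two
  by_cases hk : z0 k = z01 k
  · refine (h0.dE2_pair_lt_of_eq h1 h01 hk).le.trans ?_
    rw [div_le_one (by positivity), pow_add]
    linarith
  · have h2 := (abs_lt.1 (h0.abs_dE2_pair_lt_of_ne h1 h01 hk)).2
    have hk1 : 1 ≤ k := by
      rcases Nat.eq_zero_or_pos k with rfl | h
      · simp [z0, z01] at hk
      · exact h
    have h3 : (2 : ℝ) / 2 ^ (k + 2) ≤ 1 / 2 := by
      rw [div_le_div_iff₀ (by positivity) two_pos, pow_add]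
      linarith
    have h5 : 1 / ((k : ℝ) + 1) ≤ 1 / 2 := by
      have : (1 : ℝ) ≤ k := by exact_mod_cast hk1
      gcongr
      linarith
    linarith

theorem not_e2_z0_z01 : ¬E2 (e2MapOf g0 z0) (e2MapOf g1 z01) := by
  intro hE
  have hlow : ∀ a : ℕ, 1 / 4 * (1 / ((a : ℝ) + 1)) ≤
      dE2 (m (2 * a + 1)) (m (2 * a + 1 + 1)) (e2MapOf g0 z0) (e2MapOf g1 z01) := by
    intro a
    have h2 := (abs_lt.1 (h0.abs_dE2_pair_lt_of_ne h1 h01 (x := z0) (y := z01) (k := 2 * a + 1)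
      (by simp [z0, z01]))).1
    have h3 : (2 * a + 2 : ℝ) ≤ 2 ^ (2 * a + 1) := by
      have : 2 * a + 1 < 2 ^ (2 * a + 1) := Nat.lt_two_pow_self
      exact_mod_cast this
    have h4 : (2 : ℝ) / 2 ^ (2 * a + 1 + 2) ≤ 1 / 4 * (1 / (a + 1)) := by
      rw [show (1 : ℝ) / 4 * (1 / (a + 1)) = 1 / (4 * (a + 1)) by field_simp,
        div_le_div_iff₀ (by positivity) (by positivity), pow_add]
      linarith
    have h5 : 1 / (((2 * a + 1 : ℕ) : ℝ) + 1) = 2 * (1 / 4 * (1 / ((a : ℝ) + 1))) := by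
      push_cast
      field_simp
      ring
    linarith
  have hsum : ∀ n, 1 / 4 * ∑ a ∈ Finset.range n, 1 / ((a : ℝ) + 1) ≤
      dE2 0 (m (2 * n)) (e2MapOf g0 z0) (e2MapOf g1 z01) := by
    intro n
    induction n with
    | zero => simpa using dE2_nonneg _ _ _ _
    | succ n ih =>
      have hm1 : m (2 * n) ≤ m (2 * n + 1) := h0.mono.monotone (by omega)
      have hm2 : m (2 * n + 1) ≤ m (2 * n + 1 + 1) := h0.mono.monotone (by omega)
      rw [Finset.sum_range_succ, mul_add, show 2 * (n + 1) = 2 * n + 1 + 1 by ring,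
        ← dE2_add (Nat.zero_le _) hm2, ← dE2_add (Nat.zero_le _) hm1]
      linarith [hlow n, dE2_nonneg (m (2 * n)) (m (2 * n + 1)) (e2MapOf g0 z0) (e2MapOf g1 z01)]
  obtain ⟨l, hl⟩ := hE.exists_tailLE one_pos
  obtain ⟨n, hn⟩ := (Real.tendsto_sum_range_one_div_nat_succ_atTop.eventually_gt_atTop
    (4 * (dE2 0 l (e2MapOf g0 z0) (e2MapOf g1 z01) + 1))).exists
  have h2 := hsum n
  have h3 := dE2_le_of_subset (le_refl 0) (le_max_left (m (2 * n)) l)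
    (e2MapOf g0 z0) (e2MapOf g1 z01)
  rw [← dE2_add (Nat.zero_le l) (le_max_right (m (2 * n)) l)] at h3
  linarith [hl (max (m (2 * n)) l)]

theorem not_mem_D15_zero : (e2MapOf g0 z0, e2MapOf g1 z01) ∉ D15 0 := by
  rintro ⟨i, j, -, -, hδ, hne⟩
  dsimp only at hδ hne
  have hub := h0.dE2_z0_z01_le_one h1 h01
  have hex : ∃ k, i < m (k + 1) := ⟨i, h0.mono.le_apply.trans_lt (h0.mono i.lt_succ_self)⟩
  have hk := Nat.find_spec hex
  set k := Nat.find hex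
  have hki : m k ≤ i := by
    rcases Nat.eq_zero_or_pos k with h | h
    · rw [h, h0.zero]; exact Nat.zero_le _
    · have := Nat.find_min hex (m := k - 1) (by omega)
      rw [Nat.sub_add_cancel h] at this
      exact not_lt.1 this
  have heven : ∀ e, k < e → e % 2 = 0 → j < m (e + 1) := by
    intro e hke he
    by_contra hj
    have hie : i ≤ m e := hk.le.trans (h0.mono.monotone hke)
    have h2 := dE2_le_of_ne (fun p hp hp' => hne p (hie.trans hp) (hp'.trans_le (not_lt.1 hj)))
      (e2MapOf g0 z0) (e2MapOf g0 fun _ => true)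
    have h3 := (abs_lt.1 (h0.abs_dE2_lt_of_ne (x := z0) (y := fun _ => true) (k := e)
      (by simp [z0]))).1
    have h4 := h0.dE2_pair_lt_of_eq h1 h01 (x := z0) (y := z01) (k := e)
      (by simp [z0, z01, he])
    have h5 : (3 : ℝ) / 2 ^ (e + 2) ≤ 1 / (e + 1) := by
      have : (e + 1 : ℝ) ≤ 2 ^ e := by exact_mod_cast (Nat.lt_two_pow_self : e < 2 ^ e)
      rw [div_le_div_iff₀ (by positivity) (by positivity), pow_add]
      linarith
    have h6 : (3 : ℝ) / 2 ^ (e + 2) = 1 / 2 ^ (e + 2) + 2 / 2 ^ (e + 2) := by ring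
    linarith
  have hj : j ≤ m (k + 3) := by
    rcases Nat.mod_two_eq_zero_or_one k with h | h
    · exact (heven (k + 2) (by omega) (by omega)).le
    · exact (heven (k + 1) (by omega) (by omega)).le.trans (h0.mono.monotone (by omega))
  have h2 := dE2_le_of_subset hki hj (e2MapOf g0 z0) (e2MapOf g1 z01)
  rw [← dE2_add (h0.mono.monotone (by omega : k ≤ k + 2)) (h0.mono.monotone (by omega)),
    ← dE2_add (h0.mono.monotone (by omega : k ≤ k + 1)) (h0.mono.monotone (by omega))] at h2
  linarith [hub k, hub (k + 1), hub (k + 2)]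

end pair

end IsE2System

/-- Reverse the coordinates in `F` if `b` is `false`, those outside `F` if `b` is `true`. -/
def twist (b : Bool) (F : Finset ℕ) (x : ℕ → Bool) : ℕ → Bool :=
  fun k => x k ^^ (b ^^ decide (k ∈ F))

section twist

variable {b c : Bool} {F H : Finset ℕ} {x : ℕ → Bool}

theorem twist_apply_of_notMem {k : ℕ} (h : k ∉ F) : twist false F x k = x k := by
  simp [twist, h]

theorem twist_twist (b c : Bool) (F H : Finset ℕ) (x : ℕ → Bool) :
    twist b F (twist c H x) = twist (b ^^ c) (symmDiff F H) x := by
  funext k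
  by_cases h1 : k ∈ F <;> by_cases h2 : k ∈ H <;>
    cases b <;> cases c <;> simp [twist, Finset.mem_symmDiff, h1, h2]

theorem twist_empty : twist false ∅ x = x := by funext k; simp [twist]

theorem involutive_twist (b : Bool) (F : Finset ℕ) : Involutive (twist b F) := fun x => by
  rw [twist_twist, Bool.xor_self, symmDiff_self]; exact twist_empty

theorem continuous_twist (b : Bool) (F : Finset ℕ) : Continuous (twist b F) :=
  continuous_pi fun k =>
    (continuous_of_discreteTopology (f := fun a : Bool => a ^^ (b ^^ decide (k ∈ F)))).comp
      (continuous_apply k)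

theorem isOpenMap_twist (b : Bool) (F : Finset ℕ) : IsOpenMap (twist b F) :=
  .of_inverse (continuous_twist b F) (involutive_twist b F) (involutive_twist b F)

theorem AgreeBelow.twist {n : ℕ} {y : ℕ → Bool} (h : AgreeBelow n x y) :
    AgreeBelow n (twist b F x) (twist b F y) := fun k hk => by simp [_root_.twist, h k hk]

theorem agreeBelow_twist {n : ℕ} (h : ∀ k ∈ F, n ≤ k) : AgreeBelow n x (twist false F x) :=
  fun k hk => (twist_apply_of_notMem fun hF => (h k hF).not_gt hk).symm

theorem e2_twist (F : Finset ℕ) (x : ℕ → Bool) : E2 x (twist false F x) := by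
  refine TailLE.e2 (m := F.sup id + 1) (c := 0) fun n => le_of_eq ?_
  refine (dE2_congr_of (x' := x) (y' := x) (fun _ _ _ => rfl) fun k hk _ => ?_).trans (dE2_self ..)
  refine twist_apply_of_notMem fun hF => ?_
  exact (Finset.le_sup (f := id) hF).not_gt (Nat.lt_of_succ_le hk)

end twist

/-- A Borel self-map of Cantor space is continuous on a comeager set; the set can be taken to be
invariant under finite modifications and complementation. -/
theorem Measurable.exists_continuousOn_twist_invariant {f : (ℕ → Bool) → (ℕ → Bool)}
    (hf : Measurable f) : ∃ Y : Set (ℕ → Bool), IsGδ Y ∧ Dense Y ∧ ContinuousOn f Y ∧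
      ∀ b F, ∀ x ∈ Y, twist b F x ∈ Y := by
  have hk : ∀ p : ℕ × Bool, ∃ U : Set (ℕ → Bool), IsOpen U ∧
      ∀ᶠ x in residual (ℕ → Bool), f x p.1 = p.2 ↔ x ∈ U := by
    intro p
    have hm : MeasurableSet {x | f x p.1 = p.2} :=
      ((measurable_pi_apply p.1).comp hf) (measurableSet_singleton p.2)
    obtain ⟨U, hU, hE⟩ := hm.residualEq_isOpen
    exact ⟨U, hU, hE.mono fun x hx => iff_of_eq hx⟩
  choose U hUo hU using hk
  obtain ⟨G, hGδ, hGd, hG⟩ := eventually_residual.1 (eventually_countable_forall.2 hU)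
  refine ⟨⋂ p : Bool × Finset ℕ, twist p.1 p.2 ⁻¹' G,
    .iInter fun p => hGδ.preimage (continuous_twist _ _),
    dense_iInter_of_Gδ (fun p => hGδ.preimage (continuous_twist _ _))
      fun p => hGd.preimage (isOpenMap_twist _ _), ?_, ?_⟩
  · refine ContinuousOn.mono (s := G) ?_ fun x hx => ?_
    · refine continuousOn_pi.2 fun k => continuousOn_iff'.2 fun t _ => ?_
      refine ⟨⋃ c ∈ t, U (k, c), isOpen_biUnion fun c _ => hUo _, ?_⟩
      ext x
      simp only [mem_inter_iff, mem_preimage, mem_iUnion, exists_prop]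
      refine and_congr_left fun hx => ⟨fun h => ⟨_, h, (hG x hx (k, _)).1 rfl⟩, ?_⟩
      rintro ⟨c, hc, hxc⟩
      rwa [(hG x hx (k, c)).2 hxc]
    · have := mem_iInter.1 hx (false, ∅)
      rwa [mem_preimage, twist_empty] at this
  · intro b F x hx
    refine mem_iInter.2 fun p => ?_
    rw [mem_preimage, twist_twist]
    exact mem_iInter.1 hx (_, _)

section generic

variable {f : (ℕ → Bool) → (ℕ → Bool)} {Y : Set (ℕ → Bool)}

theorem exists_agreeBelow_dE2_eq (hfc : ContinuousOn f Y)
    (hYt : ∀ b F, ∀ x ∈ Y, twist b F x ∈ Y) {x : ℕ → Bool} (hx : x ∈ Y) (F : Finset ℕ) (n : ℕ) :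
    ∃ l, ∀ y ∈ Y, AgreeBelow l x y → AgreeBelow n (f x) (f y) ∧
      AgreeBelow n (f (twist false F x)) (f (twist false F y)) := by
  obtain ⟨l, hl⟩ := hfc.exists_agreeBelow hx n
  obtain ⟨l', hl'⟩ := hfc.exists_agreeBelow (hYt false F x hx) n
  exact ⟨max l l', fun y hy hxy => ⟨hl y hy (hxy.mono (le_max_left _ _)),
    hl' _ (hYt false F y hy) (hxy.mono (le_max_right _ _)).twist⟩⟩

/-- On some smaller cylinder the tails `δ_m^∞(f y, f (twist F y))` are uniformly small. -/
theorem exists_uniform_tailLE (hfc : ContinuousOn f Y)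
    (hYt : ∀ b F, ∀ x ∈ Y, twist b F x ∈ Y) (hYG : IsGδ Y) (hYd : Dense Y)
    (hfE : ∀ x y, E2 x y → E2 (f x) (f y)) (x : ℕ → Bool) (l : ℕ) (F : Finset ℕ) {ε : ℝ}
    (hε : 0 < ε) : ∃ z ∈ Y, AgreeBelow l x z ∧ ∃ l' m, ∀ y ∈ Y, AgreeBelow l' z y →
      TailLE m ε (f y) (f (twist false F y)) := by
  set A : ℕ → Set (ℕ → Bool) := fun m => {y | y ∈ Y ∧ TailLE m ε (f y) (f (twist false F y))}
  have hcov : Y ⊆ ⋃ m, closure (A m) := fun y hy => by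
    obtain ⟨m, hm⟩ := (hfE _ _ (e2_twist F y)).exists_tailLE hε
    exact mem_iUnion.2 ⟨m, subset_closure ⟨hy, hm⟩⟩
  have hd := hYG.dense_iUnion_interior_of_closed hYd (fun _ => isClosed_closure) hcov
  obtain ⟨p, hp, hp'⟩ := hd.inter_open_nonempty _ (isOpen_agreeBelow l x) ⟨x, AgreeBelow.rfl'⟩
  obtain ⟨m, hm⟩ := mem_iUnion.1 hp'
  obtain ⟨z, ⟨hz1, hz2⟩, hzY⟩ := hYd.inter_open_nonempty _
    ((isOpen_agreeBelow l x).inter isOpen_interior) ⟨p, hp, hm⟩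
  obtain ⟨l', hl'⟩ := exists_agreeBelow_subset isOpen_interior hz2
  refine ⟨z, hzY, hz1, l', m, fun y hy hzy n => ?_⟩
  obtain ⟨r, hr⟩ := exists_agreeBelow_dE2_eq hfc hYt hy F n
  obtain ⟨w, hw1, hw2, hw3⟩ := mem_closure_iff.1 (interior_subset (hl' y hzy)) _
    (isOpen_agreeBelow r y) AgreeBelow.rfl'
  obtain ⟨h1, h2⟩ := hr w hw2 hw1
  rw [dE2_congr h1 h2]
  exact hw3 n

theorem dE2_twist_singleton_le (m n j : ℕ) (x : ℕ → Bool) :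
    dE2 m n x (twist false {j} x) ≤ 1 / ((j : ℝ) + 1) := by
  have h : dE2 m n x (twist false {j} x) =
      ∑ k ∈ Finset.Ico m n, if k = j then 1 / ((j : ℝ) + 1) else 0 :=
    Finset.sum_congr rfl fun k _ => by
      by_cases hk : k = j
      · simp [hk, twist]
      · simp [hk, twist]
  rw [h, Finset.sum_ite_eq']
  split_ifs
  · exact le_rfl
  · positivity

/-- Every cylinder below `(z₀, l₀)` contains a smaller one on which some fixed finite modification
`H` of the free coordinates moves `f` by more than `1 / 16` beyond `m`. If `small` holds it moves
`f` by at most `1 / 4`, and if `single` holds then `H` is a single coordinate. -/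
def HasMoves (f : (ℕ → Bool) → (ℕ → Bool)) (Y : Set (ℕ → Bool)) (small single : Prop)
    (z₀ : ℕ → Bool) (l₀ m₀ : ℕ) : Prop :=
  ∀ z ∈ Y, AgreeBelow l₀ z₀ z → ∀ l, l₀ ≤ l → ∀ m, m₀ ≤ m →
    ∃ H : Finset ℕ, (∀ k ∈ H, l ≤ k) ∧ (single → ∃ j, H = {j}) ∧
      ∃ z' ∈ Y, AgreeBelow l z z' ∧ ∃ l', l ≤ l' ∧ ∀ y ∈ Y, AgreeBelow l' z' y →
        ¬TailLE m (1 / 16) (f y) (f (twist false H y)) ∧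
        (small → TailLE m (1 / 4) (f y) (f (twist false H y)))

/-- A finite stage `(z ↾ l, F, m)` of the fusion: modifying a generic point of the cylinder
`[z ↾ l]` on `F ⊆ l` moves `f` by at most `1 / 32` beyond `m`. -/
structure IsFusionStage (f : (ℕ → Bool) → (ℕ → Bool)) (Y : Set (ℕ → Bool))
    (z₀ : ℕ → Bool) (l₀ m₀ : ℕ) (z : ℕ → Bool) (l : ℕ) (F : Finset ℕ) (m : ℕ) : Prop where
  mem : z ∈ Y
  agree : AgreeBelow l₀ z₀ z
  le_l : l₀ ≤ l
  le_m : m₀ ≤ m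
  lt_of_mem : ∀ k ∈ F, k < l
  tailLE : ∀ y ∈ Y, AgreeBelow l z y → TailLE m (1 / 32) (f y) (f (twist false F y))

/-- The stage `(z', l', F', m')` extends `(z, l, F, m)` and puts both limit points into the open
set `V`. -/
structure IsFusionStep (f : (ℕ → Bool) → (ℕ → Bool)) (Y : Set (ℕ → Bool)) (small single : Prop)
    (V : Set (ℕ → Bool)) (z : ℕ → Bool) (l : ℕ) (F : Finset ℕ) (m : ℕ)
    (z' : ℕ → Bool) (l' : ℕ) (F' : Finset ℕ) (m' : ℕ) : Prop where
  lt_l : l < l'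
  lt_m : m < m'
  agree_left : AgreeBelow l z z'
  agree_right : AgreeBelow l (twist false F z) (twist false F' z')
  mem_left : ∀ y, AgreeBelow l' z' y → y ∈ V
  mem_right : ∀ y, AgreeBelow l' (twist false F' z') y → y ∈ V
  map_left : ∀ y ∈ Y, AgreeBelow l' z' y → AgreeBelow m' (f z') (f y)
  map_right : ∀ y ∈ Y, AgreeBelow l' (twist false F' z') y →
    AgreeBelow m' (f (twist false F' z')) (f y)
  lt_dE2 : 1 / 32 < dE2 m m' (f z') (f (twist false F' z'))
  dE2_le : small → dE2 m m' (f z') (f (twist false F' z')) ≤ 1 / 2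
  dE2_le_single : single → dE2 l l' z' (twist false F' z') ≤ 1 / ((l : ℝ) + 1)
  long : ∀ x y : ℕ → Bool, (∀ k, m ≤ k → k < m' → x k ≠ y k) → 10 < dE2 m m' x y

theorem IsFusionStage.exists_step (hfc : ContinuousOn f Y)
    (hYt : ∀ b F, ∀ x ∈ Y, twist b F x ∈ Y) (hYG : IsGδ Y) (hYd : Dense Y)
    (hfE : ∀ x y, E2 x y → E2 (f x) (f y)) {small single : Prop} {z₀ : ℕ → Bool} {l₀ m₀ : ℕ}
    (hmove : HasMoves f Y small single z₀ l₀ m₀) {V : Set (ℕ → Bool)} (hV : IsOpen V)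
    (hYV : Y ⊆ V) (N : ℕ) {z : ℕ → Bool} {l : ℕ} {F : Finset ℕ} {m : ℕ}
    (h : IsFusionStage f Y z₀ l₀ m₀ z l F m) :
    ∃ z' l' F' m', IsFusionStage f Y z₀ l₀ m₀ z' l' F' m' ∧
      IsFusionStep f Y small single V z l F m z' l' F' m' ∧ N ≤ l' := by
  obtain ⟨H, hHl, hHs, x, hxY, hzx, lx, hlx, hx⟩ := hmove z h.mem h.agree l h.le_l m h.le_m
  obtain ⟨w, hwY, hxw, l₁, m₁, hw⟩ :=
    exists_uniform_tailLE hfc hYt hYG hYd hfE x lx (symmDiff F H) (ε := 1 / 32) (by norm_num)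
  have hzw : AgreeBelow l z w := hzx.trans (hxw.mono hlx)
  have htw : twist false (symmDiff F H) w = twist false F (twist false H w) := by
    rw [twist_twist, Bool.xor_self]
  have hHw : AgreeBelow l w (twist false H w) := agreeBelow_twist hHl
  have hF := h.tailLE _ (hYt false H w hwY) (hzw.trans hHw)
  obtain ⟨hbig, hsmall⟩ := hx w hwY hxw
  obtain ⟨m₂, hm₂⟩ : ∃ n, 1 / 32 < dE2 m n (f w) (f (twist false (symmDiff F H) w)) := by
    by_contra! hcon
    rw [htw] at hcon
    refine hbig (((show TailLE m (1 / 32) _ _ from hcon).trans hF.symm).mono le_rfl ?_)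
    norm_num
  obtain ⟨m₃, hm₃⟩ := exists_lt_dE2_of_ne m 10
  set m' := max (max m₁ m₂) (max m₃ (m + 1)) with hm'
  have hw'Y := hYt false (symmDiff F H) w hwY
  obtain ⟨l₂, hl₂⟩ := hfc.exists_agreeBelow hwY m'
  obtain ⟨l₃, hl₃⟩ := hfc.exists_agreeBelow hw'Y m'
  obtain ⟨l₄, hl₄⟩ := exists_agreeBelow_subset hV (hYV hwY)
  obtain ⟨l₅, hl₅⟩ := exists_agreeBelow_subset hV (hYV hw'Y)
  set l' := max (max (max l₁ l₂) (max l₃ l₄)) (max (max l₅ N) (max (l + 1) (H.sup id + 1)))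
    with hl'
  refine ⟨w, l', symmDiff F H, m', ⟨hwY, h.agree.trans (hzw.mono h.le_l), h.le_l.trans (by omega),
    h.le_m.trans (by omega), fun k hk => ?_, fun y hy hwy => ?_⟩,
    ⟨by omega, by omega, hzw, ?_, fun y hy => hl₄ y (hy.mono (by omega)),
      fun y hy => hl₅ y (hy.mono (by omega)), fun y hyY hy => hl₂ y hyY (hy.mono (by omega)),
      fun y hyY hy => hl₃ y hyY (hy.mono (by omega)), ?_, fun hs => ?_, fun hs => ?_,
      fun a b hab => hm₃ m' (by omega) a b hab⟩, by omega⟩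
  · rcases Finset.mem_symmDiff.1 hk with ⟨hk, -⟩ | ⟨hk, -⟩
    · exact (h.lt_of_mem k hk).trans (by omega)
    · have := Finset.le_sup (f := id) hk
      simp only [id] at this
      omega
  · exact (hw y hy (hwy.mono (by omega))).mono (by omega) le_rfl
  · rw [htw]
    exact (hzw.trans hHw).twist
  · exact hm₂.trans_le (dE2_le_of_subset le_rfl (by omega) _ _)
  · rw [htw]
    exact (((hsmall hs).trans hF).mono le_rfl (by norm_num)) m'
  · obtain ⟨j, rfl⟩ := hHs hs
    have hj : l ≤ j := hHl j (Finset.mem_singleton_self j)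
    refine (dE2_congr_of (fun _ _ _ => rfl) fun k hk _ => ?_).trans_le
      ((dE2_twist_singleton_le l l' j w).trans (by gcongr))
    rw [htw]
    exact twist_apply_of_notMem fun hkF => (h.lt_of_mem k hkF).not_ge hk

theorem HasMoves.exists_limit (hfc : ContinuousOn f Y)
    (hYt : ∀ b F, ∀ x ∈ Y, twist b F x ∈ Y) (hYG : IsGδ Y) (hYd : Dense Y)
    (hfE : ∀ x y, E2 x y → E2 (f x) (f y)) {small single : Prop} {z₀ : ℕ → Bool} {l₀ m₀ : ℕ}
    (hz₀ : z₀ ∈ Y) (hmove : HasMoves f Y small single z₀ l₀ m₀) :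
    ∃ (z z' : ℕ → Bool) (l m : ℕ → ℕ), StrictMono l ∧ StrictMono m ∧
      ∀ n, 2 ^ n ≤ l n + 1 ∧ 1 / 32 < dE2 (m n) (m (n + 1)) (f z) (f z') ∧
        (small → dE2 (m n) (m (n + 1)) (f z) (f z') ≤ 1 / 2) ∧
        (single → dE2 (l n) (l (n + 1)) z z' ≤ 1 / ((l n : ℝ) + 1)) ∧
        ∀ x y : ℕ → Bool, (∀ k, m n ≤ k → k < m (n + 1) → x k ≠ y k) →
          10 < dE2 (m n) (m (n + 1)) x y := by
  obtain ⟨V, hVo, hYV⟩ := hYG.eq_iInter_nat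
  let Stage := {s : (ℕ → Bool) × ℕ × Finset ℕ × ℕ //
    IsFusionStage f Y z₀ l₀ m₀ s.1 s.2.1 s.2.2.1 s.2.2.2}
  have hstep : ∀ (n : ℕ) (s : Stage), ∃ t : Stage,
      IsFusionStep f Y small single (V n) s.1.1 s.1.2.1 s.1.2.2.1 s.1.2.2.2
        t.1.1 t.1.2.1 t.1.2.2.1 t.1.2.2.2 ∧ 2 ^ (n + 1) ≤ t.1.2.1 := by
    rintro n ⟨⟨z, l, F, m⟩, hs⟩
    obtain ⟨z', l', F', m', h1, h2, h3⟩ := hs.exists_step hfc hYt hYG hYd hfE hmove (hVo n)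
      (hYV.trans_subset (iInter_subset V n)) (2 ^ (n + 1))
    exact ⟨⟨⟨z', l', F', m'⟩, h1⟩, h2, h3⟩
  choose next hnext using hstep
  let s₀ : Stage := ⟨⟨z₀, l₀, ∅, m₀⟩, hz₀, .rfl', le_rfl, le_rfl, by simp, fun y _ _ => by
    rw [twist_empty]; exact TailLE.self (by norm_num)⟩
  let s : ℕ → Stage := fun n => Nat.rec s₀ (fun n t => next n t) n
  let x : ℕ → ℕ → Bool := fun n => (s n).1.1
  let l : ℕ → ℕ := fun n => (s n).1.2.1
  let x' : ℕ → ℕ → Bool := fun n => twist false (s n).1.2.2.1 (x n)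
  let m : ℕ → ℕ := fun n => (s n).1.2.2.2
  have hs : ∀ n, IsFusionStep f Y small single (V n) (x n) (l n) (s n).1.2.2.1 (m n)
      (x (n + 1)) (l (n + 1)) (s (n + 1)).1.2.2.1 (m (n + 1)) := fun n => (hnext n (s n)).1
  have hl : StrictMono l := strictMono_nat_of_lt_succ fun n => (hs n).lt_l
  have hm : StrictMono m := strictMono_nat_of_lt_succ fun n => (hs n).lt_m
  have hlim : ∀ u : ℕ → ℕ → Bool, (∀ n, AgreeBelow (l n) (u n) (u (n + 1))) →
      ∀ n, AgreeBelow (l n) (u n) fun k => u (k + 1) k := by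
    intro u hu
    have huu : ∀ a b, a ≤ b → AgreeBelow (l a) (u a) (u b) := by
      intro a b hab
      induction b, hab using Nat.le_induction with
      | base => exact .rfl'
      | succ b hab ih => exact ih.trans ((hu b).mono (hl.monotone hab))
    intro n k hk
    rcases le_total n (k + 1) with h | h
    · exact huu n (k + 1) h k hk
    · exact (huu (k + 1) n h k (hl.le_apply.trans_lt' k.lt_succ_self)).symm
  set z : ℕ → Bool := fun k => x (k + 1) k
  set z' : ℕ → Bool := fun k => x' (k + 1) k
  have hz : ∀ n, AgreeBelow (l n) (x n) z := hlim x fun n => (hs n).agree_left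
  have hz' : ∀ n, AgreeBelow (l n) (x' n) z' := hlim x' fun n => (hs n).agree_right
  have hzY : z ∈ Y := by
    rw [hYV]; exact mem_iInter.2 fun n => (hs n).mem_left z (hz (n + 1))
  have hzY' : z' ∈ Y := by
    rw [hYV]; exact mem_iInter.2 fun n => (hs n).mem_right z' (hz' (n + 1))
  refine ⟨z, z', l, m, hl, hm, fun n => ?_⟩
  have hf : dE2 (m n) (m (n + 1)) (f z) (f z') =
      dE2 (m n) (m (n + 1)) (f (x (n + 1))) (f (x' (n + 1))) :=
    (dE2_congr ((hs n).map_left z hzY (hz (n + 1)))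
      ((hs n).map_right z' hzY' (hz' (n + 1)))).symm
  rw [hf, ← dE2_congr (hz (n + 1)) (hz' (n + 1))]
  refine ⟨?_, (hs n).lt_dE2, (hs n).dE2_le, (hs n).dE2_le_single, (hs n).long⟩
  cases n with
  | zero => simp
  | succ n => exact (hnext n (s n)).2.trans (Nat.le_succ _)

theorem not_hasMoves_single (hfc : ContinuousOn f Y)
    (hYt : ∀ b F, ∀ x ∈ Y, twist b F x ∈ Y) (hYG : IsGδ Y) (hYd : Dense Y)
    (hfE : ∀ x y, E2 x y → E2 (f x) (f y)) {z₀ : ℕ → Bool} {l₀ m₀ : ℕ} (hz₀ : z₀ ∈ Y) :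
    ¬HasMoves f Y False True z₀ l₀ m₀ := by
  intro hmove
  obtain ⟨z, z', l, m, hl, hm, h⟩ := hmove.exists_limit hfc hYt hYG hYd hfE hz₀
  have hsum : ∀ n, dE2 (l 0) (l n) z z' ≤ 2 - 2 / 2 ^ n := by
    intro n
    induction n with
    | zero => simp [dE2]
    | succ n ih =>
      rw [← dE2_add (hl.monotone n.zero_le) (hl.monotone n.le_succ)]
      have h1 : (2 : ℝ) ^ n ≤ l n + 1 := by exact_mod_cast (h n).1
      have h2 := (h n).2.2.2.1 trivial
      have h3 : 1 / ((l n : ℝ) + 1) ≤ 1 / 2 ^ n := by gcongr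
      have h4 : (2 : ℝ) / 2 ^ n = 1 / 2 ^ n + 2 / 2 ^ (n + 1) := by
        rw [pow_succ]; field_simp; norm_num
      linarith
  have hE : E2 z z' := TailLE.e2 (m := l 0) (c := 2) fun n => by
    have h1 : (0 : ℝ) < 2 / 2 ^ n := by positivity
    linarith [hsum n, dE2_le_of_subset (le_refl (l 0)) (hl.le_apply (x := n)) z z']
  obtain ⟨k, hk⟩ := (hfE _ _ hE).exists_tailLE (c := 1 / 32) (by norm_num)
  have h1 := dE2_le_of_subset (hm.le_apply (x := k)) (le_refl (m (k + 1))) (f z) (f z')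
  linarith [hk (m (k + 1)), (h k).2.1]

theorem not_hasMoves_small (hfc : ContinuousOn f Y)
    (hYt : ∀ b F, ∀ x ∈ Y, twist b F x ∈ Y) (hYG : IsGδ Y) (hYd : Dense Y)
    (hfE : ∀ x y, E2 x y → E2 (f x) (f y)) {B0 B1 : Set (ℕ → Bool)} (hfB : range f ⊆ B0)
    (hB : B0 ⊆ satE2 B1) (hC : prodE2 B0 B1 ⊆ ⋂ n, D15 n)
    {z₀ : ℕ → Bool} {l₀ m₀ : ℕ} (hz₀ : z₀ ∈ Y) : ¬HasMoves f Y True False z₀ l₀ m₀ := by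
  intro hmove
  obtain ⟨z, z', l, m, hl, hm, h⟩ := hmove.exists_limit hfc hYt hYG hYd hfE hz₀
  obtain ⟨y, hyB, hy⟩ := hB (hfB (mem_range_self z'))
  have hzy : ¬E2 (f z) y := by
    intro hE
    obtain ⟨k, hk⟩ := (hE.trans hy).exists_tailLE (c := 1 / 32) (by norm_num)
    have h1 := dE2_le_of_subset (hm.le_apply (x := k)) (le_refl (m (k + 1))) (f z) (f z')
    linarith [hk (m (k + 1)), (h k).2.1]
  obtain ⟨M, hM⟩ := hy.symm.exists_tailLE (c := 1 / 2) (by norm_num)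
  obtain ⟨i, j, hi, -, hδ, hne⟩ :=
    mem_iInter.1 (hC ⟨hfB (mem_range_self z), hyB, hzy⟩ : (f z, y) ∈ ⋂ n, D15 n) (max (m 0) M)
  dsimp only at hδ hne
  have hex : ∃ k, i < m (k + 1) := ⟨i, hm.le_apply.trans_lt (hm i.lt_succ_self)⟩
  have hk := Nat.find_spec hex
  set k := Nat.find hex
  have hki : m k ≤ i := by
    rcases Nat.eq_zero_or_pos k with hk0 | hk0
    · rw [hk0]; exact (le_max_left _ _).trans hi
    · have := Nat.find_min hex (m := k - 1) (by omega)
      rw [Nat.sub_add_cancel hk0] at this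
      exact not_lt.1 this
  have hMi : M ≤ i := (le_max_right _ _).trans hi
  rcases le_total j (m (k + 2)) with hj | hj
  · have h1 := dE2_le_of_subset hki hj (f z) (f z')
    rw [← dE2_add (hm.monotone k.le_succ) (hm.monotone (Nat.le_succ _))] at h1
    linarith [dE2_triangle i j (f z) (f z') y, hM.mono hMi le_rfl j, (h k).2.2.1 trivial,
      (h (k + 1)).2.2.1 trivial]
  · have h1 := (h (k + 1)).2.2.2.2 (f z) y fun p hp hp' =>
      hne p (hk.le.trans hp) (hp'.trans_le hj)
    linarith [dE2_triangle (m (k + 1)) (m (k + 1 + 1)) (f z) (f z') y,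
      hM.mono (hMi.trans hk.le) le_rfl (m (k + 1 + 1)), (h (k + 1)).2.2.1 trivial]

theorem exists_agreeBelow_not_tailLE (hfc : ContinuousOn f Y)
    (hYt : ∀ b F, ∀ x ∈ Y, twist b F x ∈ Y) {x : ℕ → Bool} (hx : x ∈ Y) {F : Finset ℕ} {m : ℕ}
    {c : ℝ} (h : ¬TailLE m c (f x) (f (twist false F x))) :
    ∃ l, ∀ y ∈ Y, AgreeBelow l x y → ¬TailLE m c (f y) (f (twist false F y)) := by
  obtain ⟨n, hn⟩ := not_forall.1 h
  obtain ⟨l, hl⟩ := exists_agreeBelow_dE2_eq hfc hYt hx F n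
  refine ⟨l, fun y hy hxy ht => hn ?_⟩
  obtain ⟨h1, h2⟩ := hl y hy hxy
  rw [dE2_congr h1 h2]
  exact ht n

/-- On some cylinder, changing any single free coordinate moves `f` only slightly. -/
theorem exists_tailLE_twist_singleton (hfc : ContinuousOn f Y)
    (hYt : ∀ b F, ∀ x ∈ Y, twist b F x ∈ Y) (hYG : IsGδ Y) (hYd : Dense Y)
    (hfE : ∀ x y, E2 x y → E2 (f x) (f y)) :
    ∃ z₀ ∈ Y, ∃ l₀ m₀, ∀ y ∈ Y, AgreeBelow l₀ z₀ y → ∀ j, l₀ ≤ j →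
      TailLE m₀ (1 / 16) (f y) (f (twist false {j} y)) := by
  by_contra! hcon
  obtain ⟨z₀, hz₀⟩ := hYd.nonempty
  refine not_hasMoves_single hfc hYt hYG hYd hfE hz₀ (l₀ := 0) (m₀ := 0) ?_
  intro z hz _ l _ m _
  obtain ⟨y, hy, hzy, j, hj, hjy⟩ := hcon z hz l m
  obtain ⟨l', hl'⟩ := exists_agreeBelow_not_tailLE hfc hYt hy hjy
  exact ⟨{j}, by simpa using hj, fun _ => ⟨j, rfl⟩, y, hy, hzy, max l l', le_max_left _ _,
    fun w hw hyw => ⟨hl' w hw (hyw.mono (le_max_right _ _)), False.elim⟩⟩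

/-- On some cylinder, no finite modification of free coordinates moves `f` by much. -/
theorem exists_tailLE_twist (hfc : ContinuousOn f Y)
    (hYt : ∀ b F, ∀ x ∈ Y, twist b F x ∈ Y) (hYG : IsGδ Y) (hYd : Dense Y)
    (hfE : ∀ x y, E2 x y → E2 (f x) (f y)) {B0 B1 : Set (ℕ → Bool)} (hfB : range f ⊆ B0)
    (hB : B0 ⊆ satE2 B1) (hC : prodE2 B0 B1 ⊆ ⋂ n, D15 n) :
    ∃ z ∈ Y, ∃ l m, ∀ H : Finset ℕ, (∀ k ∈ H, l ≤ k) → ∀ y ∈ Y, AgreeBelow l z y →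
      TailLE m (1 / 16) (f y) (f (twist false H y)) := by
  obtain ⟨z₀, hz₀, l₀, m₀, h₀⟩ := exists_tailLE_twist_singleton hfc hYt hYG hYd hfE
  have hno := not_hasMoves_small hfc hYt hYG hYd hfE hfB hB hC hz₀ (l₀ := l₀) (m₀ := m₀)
  unfold HasMoves at hno
  push Not at hno
  obtain ⟨z, hz, hzz, l, hl, m, hm, hno⟩ := hno
  refine ⟨z, hz, l, m, fun H => ?_⟩
  induction H using Finset.induction with
  | empty => exact fun _ y _ _ => by rw [twist_empty]; exact .self (by norm_num)
  | insert j H hj ih =>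
    intro hH
    have hjl : l ≤ j := hH j (Finset.mem_insert_self j H)
    have hHl : ∀ k ∈ H, l ≤ k := fun k hk => hH k (Finset.mem_insert_of_mem hk)
    have hlarge : ∀ y ∈ Y, AgreeBelow l z y →
        TailLE m (1 / 4) (f y) (f (twist false (insert j H) y)) := by
      intro y hy hzy
      have h1 := h₀ _ (hYt false H y hy)
        ((hzz.trans (hzy.mono hl)).trans ((agreeBelow_twist hHl).mono hl)) j (hl.trans hjl)
      rw [twist_twist, Bool.xor_self, (Finset.disjoint_singleton_left.2 hj).symmDiff_eq_sup,
        Finset.sup_eq_union, ← Finset.insert_eq] at h1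
      exact ((ih hHl y hy hzy).trans (h1.mono hm le_rfl)).mono le_rfl (by norm_num)
    intro y hy hzy
    by_contra hbad
    obtain ⟨l', hl'⟩ := exists_agreeBelow_not_tailLE hfc hYt hy hbad
    obtain ⟨w, hw, hyw, hw'⟩ := hno (insert j H) hH False.elim y hy hzy (max l l')
      (le_max_left _ _)
    exact (hw' (hl' w hw (hyw.mono (le_max_right _ _)))).2
      (hlarge w hw (hzy.trans (hyw.mono (le_max_left _ _))))

end generic

theorem not_prodE2_subset_of_reduction {f : (ℕ → Bool) → (ℕ → Bool)} (hf : Measurable f)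
    {B0 B1 : Set (ℕ → Bool)} (hfB : range f ⊆ B0) (hfE : ∀ x y, E2 x y ↔ E2 (f x) (f y))
    (hB : B0 ⊆ satE2 B1) : ¬prodE2 B0 B1 ⊆ ⋂ n, D15 n := by
  intro hC
  obtain ⟨Y, hYG, hYd, hfc, hYt⟩ := hf.exists_continuousOn_twist_invariant
  obtain ⟨z, hz, l, m, h⟩ :=
    exists_tailLE_twist hfc hYt hYG hYd (fun x y => (hfE x y).1) hfB hB hC
  set v := twist true (Finset.range l) z with hv
  have hvY : v ∈ Y := hYt _ _ z hz
  have hne : ∀ k, l ≤ k → z k ≠ v k := fun k hk => by simp [hv, twist, not_lt.2 hk]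
  refine not_e2_of_ne hne ((hfE z v).2 (TailLE.e2 (m := m) (c := 1 / 16) fun n => ?_))
  obtain ⟨l', hl'⟩ := hfc.exists_agreeBelow hvY n
  have hy := hl' _ (hYt false (Finset.Ico l l') z hz) fun k hk => by
    by_cases hkl : k < l
    · simp [hv, twist, hkl, not_le.2 hkl]
    · simp [hv, twist, hkl, not_lt.1 hkl, hk]
  rw [dE2_congr AgreeBelow.rfl' hy]
  exact h (Finset.Ico l l') (fun k hk => (Finset.mem_Ico.1 hk).1) z hz .rfl' n

/-- `E₂` does not have the weak 2-Mycielski property: each `D15 n` is dense open (so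
`C = ⋂ n, D15 n` is comeager); two `E₂`-tree systems over the same `m` which are close on
every string produce a pair `(Φ⁰(0^∞), Φ¹((01)^∞))` which is `E₂`-inequivalent yet avoids
`C`; hence Borel sets `B₀, B₁` with `E₂`-reductions and equal saturations never satisfy
`B₀ ×_{E₂} B₁ ⊆ C`. -/
theorem e2_not_weak_two_mycielski :
    (∀ n, IsOpen (D15 n) ∧ Dense (D15 n)) ∧
    (⋂ n, D15 n) ∈ residual ((ℕ → Bool) × (ℕ → Bool)) ∧
    (∀ (m : ℕ → ℕ) (g0 g1 : List Bool → List Bool),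
      IsE2System m g0 → IsE2System m g1 →
      (∀ (k : ℕ) (s : List Bool), s.length = k + 1 →
        dE2L (m k) (m (k + 1)) (g0 s) (g1 s) < 1 / 2 ^ (k + 2)) →
      ¬E2 (e2MapOf g0 z0) (e2MapOf g1 z01) ∧
        (e2MapOf g0 z0, e2MapOf g1 z01) ∉ ⋂ n, D15 n) ∧
    (∀ B0 B1 : Set (ℕ → Bool), MeasurableSet B0 → MeasurableSet B1 →
      (∃ f : (ℕ → Bool) → (ℕ → Bool),
        Measurable f ∧ range f ⊆ B0 ∧ ∀ x y, E2 x y ↔ E2 (f x) (f y)) →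
      (∃ f : (ℕ → Bool) → (ℕ → Bool),
        Measurable f ∧ range f ⊆ B1 ∧ ∀ x y, E2 x y ↔ E2 (f x) (f y)) →
      satE2 B0 = satE2 B1 →
      ¬prodE2 B0 B1 ⊆ ⋂ n, D15 n) := by
  refine ⟨fun n => ⟨isOpen_D15 n, dense_D15 n⟩, ?_, fun m g0 g1 h0 h1 h01 => ?_, ?_⟩
  · exact countable_iInter_mem.2 fun n => residual_of_dense_open (isOpen_D15 n) (dense_D15 n)
  · exact ⟨h0.not_e2_z0_z01 h1 h01, fun h => h0.not_mem_D15_zero h1 h01 (mem_iInter.1 h 0)⟩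
  · rintro B0 B1 - - ⟨f, hf, hfB, hfE⟩ - hsat
    refine not_prodE2_subset_of_reduction hf hfB hfE (hsat ▸ fun x hx => ?_)
    exact ⟨x, hx, (TailLE.self (m := 0) le_rfl).e2⟩
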